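/- arXiv:2103.08608 — 6 statements merged into one kernel-verified Lean document; each statement's English description precedes it below -/
import Mathlib

section
/- Zero-locus reduction (Proposition 2 of the paper): Let A be a ℤ-graded commutative ℝ-algebra equipped with a graded Poisson bracket [·,·] of degree −n and a compatible Q-structure Z, and let I_Z be the two-sided ideal generated by the image of Z. Then I_Z is a homogeneous ideal, the quotient algebra A/I_Z inherits a ℤ-grading, and the derived bracket induces a well-defined ℝ-bilinear bracket {·,·} on A/I_Z determined by {π(f), π(g)} = π([f, Z(g)]) (where π : A → A/I_Z is the quotient map), which is a graded Poisson bracket of degree −(n−1) on A/I_Z: it maps classes of homogeneous elements of degrees j and k to degree j + k − (n−1), and it satisfies the graded antisymmetry, graded Leibniz, and graded Jacobi identities of a degree −(n−1) graded Poisson bracket. -/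
/-- A graded Poisson bracket of degree `-n` on a ℤ-graded
(Koszul-sign graded-commutative) ℝ-algebra `A` with grading `𝒜`. -/
structure GradedPoissonBracket (A : Type*) [Ring A] [Algebra ℝ A]
    (𝒜 : ℤ → Submodule ℝ A) (n : ℤ) where
  koszul : ∀ ⦃j k : ℤ⦄ ⦃f g : A⦄, f ∈ 𝒜 j → g ∈ 𝒜 k →
    f * g = ((-1 : ℝ) ^ (j * k)) • (g * f)
  bracket : A →ₗ[ℝ] A →ₗ[ℝ] A
  bracket_mem : ∀ ⦃j k : ℤ⦄ ⦃f g : A⦄, f ∈ 𝒜 j → g ∈ 𝒜 k →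
    bracket f g ∈ 𝒜 (j + k - n)
  antisymm : ∀ ⦃j k : ℤ⦄ ⦃f g : A⦄, f ∈ 𝒜 j → g ∈ 𝒜 k →
    bracket f g = -(((-1 : ℝ) ^ ((j + n) * (k + n))) • bracket g f)
  leibniz : ∀ ⦃j k l : ℤ⦄ ⦃f g h : A⦄, f ∈ 𝒜 j → g ∈ 𝒜 k → h ∈ 𝒜 l →
    bracket f (g * h) = bracket f g * h + ((-1 : ℝ) ^ ((j + n) * k)) • (g * bracket f h)
  jacobi : ∀ ⦃j k l : ℤ⦄ ⦃f g h : A⦄, f ∈ 𝒜 j → g ∈ 𝒜 k → h ∈ 𝒜 l →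
    bracket f (bracket g h) = bracket (bracket f g) h +
      ((-1 : ℝ) ^ ((j + n) * (k + n))) • bracket g (bracket f h)

/-- A Q-structure compatible with a graded Poisson bracket of degree `-n`. -/
structure QStructure {A : Type*} [Ring A] [Algebra ℝ A]
    {𝒜 : ℤ → Submodule ℝ A} {n : ℤ} (P : GradedPoissonBracket A 𝒜 n) where
  Z : A →ₗ[ℝ] A
  Z_mem : ∀ ⦃k : ℤ⦄ ⦃f : A⦄, f ∈ 𝒜 k → Z f ∈ 𝒜 (k + 1)
  Z_sq : ∀ f : A, Z (Z f) = 0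
  Z_deriv : ∀ ⦃k : ℤ⦄ ⦃f : A⦄, f ∈ 𝒜 k → ∀ g : A,
    Z (f * g) = Z f * g + ((-1 : ℝ) ^ k) • (f * Z g)
  Z_compat : ∀ ⦃k : ℤ⦄ ⦃f : A⦄, f ∈ 𝒜 k → ∀ g : A,
    Z (P.bracket f g) = P.bracket (Z f) g + ((-1 : ℝ) ^ (k + n)) • P.bracket f (Z g)

section Helpers

variable {A : Type*} [Ring A] [Algebra ℝ A]

theorem TwoSidedIdeal.real_smul_mem (I : TwoSidedIdeal A) (r : ℝ) {x : A} (hx : x ∈ I) :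
    r • x ∈ I := by
  rw [Algebra.smul_def]
  exact I.mul_mem_left _ _ hx

variable {𝒜 : ℤ → Submodule ℝ A} {n : ℤ} {P : GradedPoissonBracket A 𝒜 n}

namespace QStructure

/-- The two-sided ideal generated by the image of `Z`. -/
abbrev ideal (Q : QStructure P) : TwoSidedIdeal A := TwoSidedIdeal.span (Set.range Q.Z)

variable (Q : QStructure P)

theorem Z_mem_ideal (x : A) : Q.Z x ∈ Q.ideal :=
  TwoSidedIdeal.subset_span ⟨x, rfl⟩

/-- The ideal is additively generated by the products `a * Z b * c` of homogeneous elements. -/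
theorem ideal_induction [GradedRing 𝒜] {p : A → Prop} (zero : p 0)
    (add : ∀ x y, p x → p y → p (x + y))
    (mem : ∀ ⦃j k l : ℤ⦄ ⦃a b c : A⦄, a ∈ 𝒜 j → b ∈ 𝒜 k → c ∈ 𝒜 l → p (a * Q.Z b * c))
    {x : A} (hx : x ∈ Q.ideal) : p x := by
  suffices h : ∀ a c, p (a * x * c) by simpa using h 1 1
  induction hx using TwoSidedIdeal.span_induction with
  | mem x hx =>
    obtain ⟨b, rfl⟩ := hx
    intro a c
    induction a using DirectSum.Decomposition.inductionOn 𝒜 with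
    | zero => simpa using zero
    | add a a' h h' => simpa only [add_mul] using add _ _ h h'
    | homogeneous a =>
      induction b using DirectSum.Decomposition.inductionOn 𝒜 with
      | zero => simpa using zero
      | add b b' h h' => simpa only [map_add, mul_add, add_mul] using add _ _ h h'
      | homogeneous b =>
        induction c using DirectSum.Decomposition.inductionOn 𝒜 with
        | zero => simpa using zero
        | add c c' h h' => simpa only [mul_add] using add _ _ h h'
        | homogeneous c => exact mem a.2 b.2 c.2
  | zero => simpa using zero
  | add x y _ _ hx hy =>
    intro a c
    simpa only [mul_add, add_mul] using add _ _ (hx a c) (hy a c)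
  | neg x _ hx =>
    intro a c
    simpa using hx (-a) c
  | left_absorb b x _ hx =>
    intro a c
    simpa only [mul_assoc] using hx (a * b) c
  | right_absorb b x _ hx =>
    intro a c
    simpa only [mul_assoc] using hx a (b * c)

theorem decompose_mem_ideal [GradedRing 𝒜] {x : A} (hx : x ∈ Q.ideal) (k : ℤ) :
    (DirectSum.decompose 𝒜 x k : A) ∈ Q.ideal := by
  refine Q.ideal_induction (p := fun x => (DirectSum.decompose 𝒜 x k : A) ∈ Q.ideal)
    (by simp) (fun x y hx hy => by simpa using add_mem hx hy)
    (fun j i l a b c ha hb hc => ?_) hx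
  have hm := SetLike.mul_mem_graded (SetLike.mul_mem_graded ha (Q.Z_mem hb)) hc
  by_cases h : j + (i + 1) + l = k
  · subst h
    rw [DirectSum.decompose_of_mem_same 𝒜 hm]
    exact TwoSidedIdeal.mul_mem_right _ _ _
      (TwoSidedIdeal.mul_mem_left _ _ _ (Q.Z_mem_ideal b))
  · rw [DirectSum.decompose_of_mem_ne 𝒜 hm h]
    exact zero_mem _

theorem bracket_Z_Z_mem {k : ℤ} {g : A} (hg : g ∈ 𝒜 k) (x : A) :
    P.bracket (Q.Z g) (Q.Z x) ∈ Q.ideal := by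
  have h := Q.Z_compat hg (Q.Z x)
  rw [Q.Z_sq, map_zero, smul_zero, add_zero] at h
  exact h ▸ Q.Z_mem_ideal _

/-- The Hamiltonian derivation of `Z g` preserves the ideal. -/
theorem bracket_Z_left_mem [GradedRing 𝒜] {k : ℤ} {g x : A} (hg : g ∈ 𝒜 k)
    (hx : x ∈ Q.ideal) : P.bracket (Q.Z g) x ∈ Q.ideal := by
  refine Q.ideal_induction (p := fun x => P.bracket (Q.Z g) x ∈ Q.ideal)
    (by simp) (fun x y hx hy => by simpa using add_mem hx hy)
    (fun j i l a b c ha hb hc => ?_) hx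
  have hZ := Q.Z_mem_ideal b
  rw [P.leibniz (Q.Z_mem hg) (SetLike.mul_mem_graded ha (Q.Z_mem hb)) hc,
    P.leibniz (Q.Z_mem hg) ha (Q.Z_mem hb)]
  refine add_mem (TwoSidedIdeal.mul_mem_right _ _ _ (add_mem ?_ ?_)) ?_
  · exact TwoSidedIdeal.mul_mem_left _ _ _ hZ
  · exact TwoSidedIdeal.real_smul_mem _ _
      (TwoSidedIdeal.mul_mem_left _ _ _ (Q.bracket_Z_Z_mem hg b))
  · exact TwoSidedIdeal.real_smul_mem _ _
      (TwoSidedIdeal.mul_mem_right _ _ _ (TwoSidedIdeal.mul_mem_left _ _ _ hZ))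

theorem bracket_Z_mem_of_left_mem [GradedRing 𝒜] {f : A} (hf : f ∈ Q.ideal) (g : A) :
    P.bracket f (Q.Z g) ∈ Q.ideal := by
  classical
  induction g using DirectSum.Decomposition.inductionOn 𝒜 with
  | zero => simp
  | add g g' h h' =>
    simpa using add_mem h h'
  | homogeneous g =>
    rw [← DirectSum.sum_support_decompose 𝒜 f, map_sum, LinearMap.sum_apply]
    refine TwoSidedIdeal.finsetSum_mem _ _ _ fun i _ => ?_
    rw [P.antisymm (DirectSum.decompose 𝒜 f i).2 (Q.Z_mem g.2)]
    exact neg_mem (TwoSidedIdeal.real_smul_mem _ _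
      (Q.bracket_Z_left_mem g.2 (Q.decompose_mem_ideal hf i)))

/-- Modulo the ideal, `Z` can be moved across the bracket up to a sign. -/
theorem bracket_Z_add_mem {j : ℤ} {f : A} (hf : f ∈ 𝒜 j) (g : A) :
    P.bracket f (Q.Z g) + ((-1 : ℝ) ^ (j + n)) • P.bracket (Q.Z f) g ∈ Q.ideal := by
  have h := TwoSidedIdeal.real_smul_mem _ ((-1 : ℝ) ^ (j + n))
    (Q.Z_mem_ideal (P.bracket f g))
  rw [Q.Z_compat hf, smul_add, smul_smul, ← mul_zpow, neg_one_mul, neg_neg, one_zpow,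
    one_smul, add_comm] at h
  exact h

theorem bracket_Z_mem_of_right_mem [GradedRing 𝒜] (f : A) {g : A} (hg : g ∈ Q.ideal) :
    P.bracket f (Q.Z g) ∈ Q.ideal := by
  induction f using DirectSum.Decomposition.inductionOn 𝒜 with
  | zero => simp
  | add f f' h h' =>
    simpa using add_mem h h'
  | homogeneous f =>
    exact (add_mem_cancel_right (TwoSidedIdeal.real_smul_mem _ _
      (Q.bracket_Z_left_mem f.2 hg))).mp (Q.bracket_Z_add_mem f.2 g)

end QStructure

end Helpers

/-- **Zero-locus reduction** (Proposition 2): the two-sided ideal `I_Z` generated by the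
image of `Z` is homogeneous, the quotient inherits the ℤ-grading, and the derived bracket
`{f,g} = [f, Z g]` descends to a well-defined graded Poisson bracket of degree `-(n-1)`
on `A/I_Z`, satisfying graded antisymmetry, Leibniz and Jacobi identities. -/
theorem zero_locus_reduction
    {A : Type*} [Ring A] [Algebra ℝ A] {𝒜 : ℤ → Submodule ℝ A} [GradedRing 𝒜] {n : ℤ}
    (P : GradedPoissonBracket A 𝒜 n) (Q : QStructure P)
    (I : TwoSidedIdeal A) (hI : I = TwoSidedIdeal.span (Set.range Q.Z)) :
    -- (a) `I_Z` is a homogeneous ideal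
    (∀ x ∈ I, ∀ k : ℤ, (DirectSum.decompose 𝒜 x k : A) ∈ I) ∧
    -- (b) the quotient `A/I_Z` inherits a ℤ-grading: it is spanned by classes of
    -- homogeneous elements
    (∀ x : A, ∃ (s : Finset ℤ) (c : ℤ → A),
      (∀ k ∈ s, c k ∈ 𝒜 k) ∧ x - ∑ k ∈ s, c k ∈ I) ∧
    -- (c) the derived bracket descends to a well-defined (ℝ-bilinear) bracket on `A/I_Z`
    (∀ f f' g g' : A, f - f' ∈ I → g - g' ∈ I →
      P.bracket f (Q.Z g) - P.bracket f' (Q.Z g') ∈ I) ∧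
    -- (d) the induced bracket has degree `-(n-1)`
    (∀ ⦃j k : ℤ⦄ ⦃f g : A⦄, f ∈ 𝒜 j → g ∈ 𝒜 k →
      P.bracket f (Q.Z g) ∈ 𝒜 (j + k - (n - 1))) ∧
    -- (e) graded antisymmetry modulo `I_Z`
    (∀ ⦃j k : ℤ⦄ ⦃f g : A⦄, f ∈ 𝒜 j → g ∈ 𝒜 k →
      P.bracket f (Q.Z g) +
        ((-1 : ℝ) ^ ((j + n + 1) * (k + n + 1))) • P.bracket g (Q.Z f) ∈ I) ∧
    -- (f) graded Leibniz rule modulo `I_Z`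
    (∀ ⦃j k l : ℤ⦄ ⦃f g h : A⦄, f ∈ 𝒜 j → g ∈ 𝒜 k → h ∈ 𝒜 l →
      P.bracket f (Q.Z (g * h)) - P.bracket f (Q.Z g) * h
        - ((-1 : ℝ) ^ ((j + n + 1) * k)) • (g * P.bracket f (Q.Z h)) ∈ I) ∧
    -- (g) graded Jacobi identity modulo `I_Z`
    (∀ ⦃j k l : ℤ⦄ ⦃f g h : A⦄, f ∈ 𝒜 j → g ∈ 𝒜 k → h ∈ 𝒜 l →
      P.bracket f (Q.Z (P.bracket g (Q.Z h)))
        - P.bracket (P.bracket f (Q.Z g)) (Q.Z h)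
        - ((-1 : ℝ) ^ ((j + n + 1) * (k + n + 1))) •
            P.bracket g (Q.Z (P.bracket f (Q.Z h))) ∈ I) := by
  subst hI
  have hne : (-1 : ℝ) ≠ 0 := by norm_num
  refine ⟨fun x hx k => Q.decompose_mem_ideal hx k, ?_, ?_, ?_, ?_, ?_, ?_⟩
  · classical
    intro x
    refine ⟨(DirectSum.decompose 𝒜 x).support, fun k => DirectSum.decompose 𝒜 x k,
      fun k _ => (DirectSum.decompose 𝒜 x k).2, ?_⟩
    rw [DirectSum.sum_support_decompose, sub_self]
    exact zero_mem _
  · intro f f' g g' hf hg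
    have h := add_mem (Q.bracket_Z_mem_of_left_mem hf g) (Q.bracket_Z_mem_of_right_mem f' hg)
    simpa using h
  · intro j k f g hf hg
    rw [show j + k - (n - 1) = j + (k + 1) - n by ring]
    exact P.bracket_mem hf (Q.Z_mem hg)
  · intro j k f g hf hg
    have h := Q.bracket_Z_add_mem hf g
    rw [P.antisymm (Q.Z_mem hf) hg, smul_neg, smul_smul, ← zpow_add₀ hne, ← neg_smul] at h
    convert h using 3
    rw [show (j + n + 1) * (k + n + 1) = j + n + (j + 1 + n) * (k + n) + 1 by ring,
      zpow_add_one₀ hne, mul_neg_one]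
  · intro j k l f g h hf hg hh
    rw [Q.Z_deriv hg, map_add, map_smul, P.leibniz hf (Q.Z_mem hg) hh,
      P.leibniz hf hg (Q.Z_mem hh), smul_add, smul_smul, ← zpow_add₀ hne,
      show k + (j + n) * k = (j + n + 1) * k by ring]
    have h₁ := TwoSidedIdeal.mul_mem_right _ _ (P.bracket f h) (Q.Z_mem_ideal g)
    have h₂ := TwoSidedIdeal.mul_mem_left _ (P.bracket f g) _ (Q.Z_mem_ideal h)
    convert add_mem (TwoSidedIdeal.real_smul_mem _ ((-1 : ℝ) ^ ((j + n) * (k + 1))) h₁)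
      (TwoSidedIdeal.real_smul_mem _ ((-1 : ℝ) ^ k) h₂) using 1
    abel
  · intro j k l f g h hf hg hh
    have hZ := Q.Z_compat hg (Q.Z h)
    rw [Q.Z_sq, map_zero, smul_zero, add_zero] at hZ
    rw [hZ, P.jacobi hf (Q.Z_mem hg) (Q.Z_mem hh), add_sub_cancel_left]
    have hs := TwoSidedIdeal.real_smul_mem _ ((-1 : ℝ) ^ ((j + n + 1) * (k + n + 1)))
      (Q.bracket_Z_add_mem hg (P.bracket f (Q.Z h)))
    rw [smul_add, smul_smul, ← zpow_add₀ hne] at hs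
    have he : (-1 : ℝ) ^ ((j + n + 1) * (k + n + 1) + (k + n)) =
        -(-1 : ℝ) ^ ((j + n) * (k + 1 + n)) := by
      rw [show (j + n + 1) * (k + n + 1) + (k + n) =
          (j + n) * (k + 1 + n) + 2 * (k + n) + 1 by ring, zpow_add_one₀ hne, zpow_add₀ hne,
        zpow_mul _ 2]
      norm_num
    rw [he] at hs
    convert neg_mem hs using 1
    rw [neg_smul]
    abel
end

section
/- Well-definedness of the zero-locus derived bracket: Let A be a ℤ-graded commutative ℝ-algebra with a graded Poisson bracket [·,·] of degree −n and a compatible Q-structure Z. If f ≡ f' (mod I_Z) and g ≡ g' (mod I_Z), then [f, Z(g)] ≡ [f', Z(g')] (mod I_Z). In particular the derived bracket {f,g} = [f, Z(g)] descends to a well-defined ℝ-bilinear map on the quotient A/I_Z. -/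
namespace QStructure

variable {A : Type*} [Ring A] [Algebra ℝ A] {𝒜 : ℤ → Submodule ℝ A} {n : ℤ}
  {P : GradedPoissonBracket A 𝒜 n}

/-- The two-sided ideal generated by the image of `Z`, as a real subspace. -/
def idealSubmodule (Q : QStructure P) : Submodule ℝ A where
  carrier := TwoSidedIdeal.span (Set.range Q.Z)
  add_mem' hx hy := by
    rw [SetLike.mem_coe] at hx hy ⊢
    exact TwoSidedIdeal.add_mem _ hx hy
  zero_mem' := by
    rw [SetLike.mem_coe]
    exact TwoSidedIdeal.zero_mem _
  smul_mem' r x hx := by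
    rw [SetLike.mem_coe] at hx ⊢
    rw [Algebra.smul_def]
    exact TwoSidedIdeal.mul_mem_left _ _ _ hx

theorem mem_idealSubmodule (Q : QStructure P) {x : A} :
    x ∈ Q.idealSubmodule ↔ x ∈ TwoSidedIdeal.span (Set.range Q.Z) :=
  Iff.rfl

theorem Z_mem_idealSubmodule (Q : QStructure P) (x : A) : Q.Z x ∈ Q.idealSubmodule :=
  Q.mem_idealSubmodule.2 (TwoSidedIdeal.subset_span (Set.mem_range_self x))

theorem mul_left_mem_idealSubmodule (Q : QStructure P) (a : A) {x : A}
    (hx : x ∈ Q.idealSubmodule) : a * x ∈ Q.idealSubmodule :=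
  Q.mem_idealSubmodule.2 (TwoSidedIdeal.mul_mem_left _ _ _ (Q.mem_idealSubmodule.1 hx))

theorem mul_right_mem_idealSubmodule (Q : QStructure P) (a : A) {x : A}
    (hx : x ∈ Q.idealSubmodule) : x * a ∈ Q.idealSubmodule :=
  Q.mem_idealSubmodule.2 (TwoSidedIdeal.mul_mem_right _ _ _ (Q.mem_idealSubmodule.1 hx))

/-- A linear map sends the ideal of `Z` into a subspace as soon as it does so on the products
`a * Z b` with `a` and `b` homogeneous. -/
theorem map_mem_of_homogeneous [GradedRing 𝒜] (Q : QStructure P) (φ : A →ₗ[ℝ] A)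
    (S : Submodule ℝ A)
    (h : ∀ ⦃j k : ℤ⦄ ⦃a b : A⦄, a ∈ 𝒜 j → b ∈ 𝒜 k → φ (a * Q.Z b) ∈ S)
    {x : A} (hx : x ∈ Q.idealSubmodule) : φ x ∈ S := by
  rw [mem_idealSubmodule, TwoSidedIdeal.mem_span_iff_mem_addSubgroup_closure] at hx
  induction hx using AddSubgroup.closure_induction with
  | zero => simp
  | add x y _ _ hx hy => rw [map_add]; exact S.add_mem hx hy
  | neg x _ hx => rw [map_neg]; exact S.neg_mem hx
  | mem x hx =>
    obtain ⟨_, ⟨a, -, _, ⟨b, rfl⟩, rfl⟩, c, -, rfl⟩ := hx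
    simp only
    induction a using DirectSum.Decomposition.inductionOn 𝒜 with
    | zero => simp
    | add a a' ha ha' => rw [add_mul, add_mul, map_add]; exact S.add_mem ha ha'
    | homogeneous a =>
      induction b using DirectSum.Decomposition.inductionOn 𝒜 with
      | zero => simp
      | add b b' hb hb' => rw [map_add, mul_add, add_mul, map_add]; exact S.add_mem hb hb'
      | homogeneous b =>
        induction c using DirectSum.Decomposition.inductionOn 𝒜 with
        | zero => simp
        | add c c' hc hc' => rw [mul_add, map_add]; exact S.add_mem hc hc'
        | homogeneous c =>
          rw [mul_assoc, P.koszul (Q.Z_mem b.2) c.2, mul_smul_comm, ← mul_assoc, map_smul]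
          exact S.smul_mem _ (h (SetLike.mul_mem_graded a.2 c.2) b.2)

/-- The bracket of two elements of the image of `Z` lies in the image of `Z`. -/
theorem bracket_Z_Z (Q : QStructure P) {k : ℤ} {f : A} (hf : f ∈ 𝒜 k) (g : A) :
    P.bracket (Q.Z f) (Q.Z g) = Q.Z (P.bracket f (Q.Z g)) := by
  rw [Q.Z_compat hf, Q.Z_sq, map_zero, smul_zero, add_zero]

theorem bracket_Z_mem_of_mem_right [GradedRing 𝒜] (Q : QStructure P) (f : A) {g : A}
    (hg : g ∈ Q.idealSubmodule) : P.bracket f (Q.Z g) ∈ Q.idealSubmodule := by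
  induction f using DirectSum.Decomposition.inductionOn 𝒜 with
  | zero => simp
  | add f f' hf hf' =>
    rw [map_add, LinearMap.add_apply]
    exact Submodule.add_mem _ hf hf'
  | homogeneous f =>
    refine Q.map_mem_of_homogeneous (P.bracket (f : A) ∘ₗ Q.Z) _ (fun j k a b ha hb => ?_) hg
    rw [LinearMap.comp_apply, Q.Z_deriv ha, Q.Z_sq, mul_zero, smul_zero, add_zero,
      P.leibniz f.2 (Q.Z_mem ha) (Q.Z_mem hb)]
    exact Submodule.add_mem _ (Q.mul_left_mem_idealSubmodule _ (Q.Z_mem_idealSubmodule b))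
      (Submodule.smul_mem _ _ (Q.mul_right_mem_idealSubmodule _ (Q.Z_mem_idealSubmodule a)))

theorem bracket_Z_mem_of_mem_left [GradedRing 𝒜] (Q : QStructure P) {f : A}
    (hf : f ∈ Q.idealSubmodule) (g : A) : P.bracket f (Q.Z g) ∈ Q.idealSubmodule := by
  induction g using DirectSum.Decomposition.inductionOn 𝒜 with
  | zero => simp
  | add g g' hg hg' =>
    rw [map_add, map_add]
    exact Submodule.add_mem _ hg hg'
  | homogeneous g =>
    refine Q.map_mem_of_homogeneous (P.bracket.flip (Q.Z g)) _ (fun j k a b ha hb => ?_) hf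
    rw [LinearMap.flip_apply,
      P.antisymm (SetLike.mul_mem_graded ha (Q.Z_mem hb)) (Q.Z_mem g.2),
      P.leibniz (Q.Z_mem g.2) ha (Q.Z_mem hb), Q.bracket_Z_Z g.2]
    exact Submodule.neg_mem _ (Submodule.smul_mem _ _ (Submodule.add_mem _
      (Q.mul_left_mem_idealSubmodule _ (Q.Z_mem_idealSubmodule b))
      (Submodule.smul_mem _ _ (Q.mul_left_mem_idealSubmodule _ (Q.Z_mem_idealSubmodule _)))))

end QStructure

/-- **Well-definedness of the zero-locus derived bracket**: if `f ≡ f'` and `g ≡ g'`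
modulo the two-sided ideal `I_Z` generated by the image of `Z`, then
`[f, Z g] ≡ [f', Z g']` modulo `I_Z`; hence the derived bracket descends to `A/I_Z`. -/
theorem derived_bracket_well_defined
    {A : Type*} [Ring A] [Algebra ℝ A] {𝒜 : ℤ → Submodule ℝ A} [GradedRing 𝒜] {n : ℤ}
    (P : GradedPoissonBracket A 𝒜 n) (Q : QStructure P)
    (I : TwoSidedIdeal A) (hI : I = TwoSidedIdeal.span (Set.range Q.Z))
    (f f' g g' : A) (hf : f - f' ∈ I) (hg : g - g' ∈ I) :
    P.bracket f (Q.Z g) - P.bracket f' (Q.Z g') ∈ I := by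
  subst hI
  have key : P.bracket f (Q.Z g) - P.bracket f' (Q.Z g') =
      P.bracket (f - f') (Q.Z g) + P.bracket f' (Q.Z (g - g')) := by
    simp
  rw [← Q.mem_idealSubmodule] at hf hg ⊢
  rw [key]
  exact Submodule.add_mem _ (Q.bracket_Z_mem_of_mem_left hf g)
    (Q.bracket_Z_mem_of_mem_right f' hg)
end

section
/- Graded antisymmetry of the zero-locus derived bracket: Let A be a ℤ-graded commutative ℝ-algebra with a graded Poisson bracket [·,·] of degree −n and a compatible Q-structure Z. Then for all homogeneous f, g ∈ A one has [f, Z(g)] + (−1)^{(|f|+n+1)(|g|+n+1)} [g, Z(f)] ∈ I_Z; that is, the derived bracket induced on the quotient A/I_Z satisfies the graded antisymmetry identity of a degree −(n−1) graded Poisson bracket. -/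
/-- The graded symmetrization of the derived bracket of homogeneous elements is `Z`-exact. -/
theorem QStructure.bracket_Z_add_smul_bracket_Z
    {A : Type*} [Ring A] [Algebra ℝ A] {𝒜 : ℤ → Submodule ℝ A} {n : ℤ}
    {P : GradedPoissonBracket A 𝒜 n} (Q : QStructure P)
    {j k : ℤ} {f g : A} (hf : f ∈ 𝒜 j) (hg : g ∈ 𝒜 k) :
    P.bracket f (Q.Z g) +
      ((-1 : ℝ) ^ ((j + n + 1) * (k + n + 1))) • P.bracket g (Q.Z f) =
      Q.Z (((-1 : ℝ) ^ (j + n)) • P.bracket f g) := by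
  have h0 : (-1 : ℝ) ≠ 0 := by norm_num
  have hsq : (-1 : ℝ) ^ (j + n) * (-1 : ℝ) ^ (j + n) = 1 := by
    rw [← mul_zpow]; norm_num
  have hexp : (-1 : ℝ) ^ ((j + n + 1) * (k + n + 1)) =
      -((-1 : ℝ) ^ (j + n) * (-1 : ℝ) ^ ((j + 1 + n) * (k + n))) := by
    rw [show (j + n + 1) * (k + n + 1) = (j + n) + (j + 1 + n) * (k + n) + 1 by ring,
      zpow_add_one₀ h0, zpow_add₀ h0]
    ring
  rw [map_smul, Q.Z_compat hf, P.antisymm (Q.Z_mem hf) hg, smul_add, smul_smul, hsq, hexp,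
    smul_neg, smul_smul, one_smul, neg_smul, add_comm]

/-- **Graded antisymmetry of the zero-locus derived bracket**: for homogeneous `f, g`,
`[f, Z g] + (-1)^{(|f|+n+1)(|g|+n+1)} [g, Z f] ∈ I_Z`. -/
theorem derived_bracket_antisymm
    {A : Type*} [Ring A] [Algebra ℝ A] {𝒜 : ℤ → Submodule ℝ A} {n : ℤ}
    (P : GradedPoissonBracket A 𝒜 n) (Q : QStructure P)
    (I : TwoSidedIdeal A) (hI : I = TwoSidedIdeal.span (Set.range Q.Z))
    {j k : ℤ} {f g : A} (hf : f ∈ 𝒜 j) (hg : g ∈ 𝒜 k) :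
    P.bracket f (Q.Z g) +
      ((-1 : ℝ) ^ ((j + n + 1) * (k + n + 1))) • P.bracket g (Q.Z f) ∈ I := by
  rw [Q.bracket_Z_add_smul_bracket_Z hf hg, hI]
  exact TwoSidedIdeal.subset_span (Set.mem_range_self _)
end

section
/- Graded Leibniz rule for the zero-locus derived bracket: Let A be a ℤ-graded commutative ℝ-algebra with a graded Poisson bracket [·,·] of degree −n and a compatible Q-structure Z. Then for all homogeneous f, g, h ∈ A one has [f, Z(g·h)] − [f, Z(g)]·h − (−1)^{(|f|+n+1)|g|} g·[f, Z(h)] ∈ I_Z; that is, the derived bracket induced on the quotient A/I_Z satisfies the graded Leibniz rule of a degree −(n−1) graded Poisson bracket. -/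
/-- **Graded Leibniz rule for the zero-locus derived bracket**: for homogeneous `f, g, h`,
`[f, Z(g·h)] − [f, Z g]·h − (−1)^{(|f|+n+1)|g|} g·[f, Z h] ∈ I_Z`. -/
theorem derived_bracket_leibniz
    {A : Type*} [Ring A] [Algebra ℝ A] {𝒜 : ℤ → Submodule ℝ A} {n : ℤ}
    (P : GradedPoissonBracket A 𝒜 n) (Q : QStructure P)
    (I : TwoSidedIdeal A) (hI : I = TwoSidedIdeal.span (Set.range Q.Z))
    {j k l : ℤ} {f g h : A} (hf : f ∈ 𝒜 j) (hg : g ∈ 𝒜 k) (hh : h ∈ 𝒜 l) :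
    P.bracket f (Q.Z (g * h)) - P.bracket f (Q.Z g) * h
      - ((-1 : ℝ) ^ ((j + n + 1) * k)) • (g * P.bracket f (Q.Z h)) ∈ I := by
  subst hI
  have hZ (x : A) : Q.Z x ∈ TwoSidedIdeal.span (Set.range Q.Z) :=
    TwoSidedIdeal.subset_span ⟨x, rfl⟩
  have hsign : (-1 : ℝ) ^ ((j + n + 1) * k) = (-1) ^ k * (-1) ^ ((j + n) * k) := by
    rw [← zpow_add₀ (by norm_num)]
    congr 1
    ring
  have key : P.bracket f (Q.Z (g * h)) - P.bracket f (Q.Z g) * h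
      - ((-1 : ℝ) ^ ((j + n + 1) * k)) • (g * P.bracket f (Q.Z h))
      = algebraMap ℝ A ((-1) ^ ((j + n) * (k + 1))) * (Q.Z g * P.bracket f h)
        + algebraMap ℝ A ((-1) ^ k) * (P.bracket f g * Q.Z h) := by
    rw [Q.Z_deriv hg, map_add, map_smul, P.leibniz hf (Q.Z_mem hg) hh,
      P.leibniz hf hg (Q.Z_mem hh), hsign, mul_smul, smul_add, ← Algebra.smul_def,
      ← Algebra.smul_def]
    abel
  rw [key]
  exact add_mem (TwoSidedIdeal.mul_mem_left _ _ _ (TwoSidedIdeal.mul_mem_right _ _ _ (hZ g)))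
    (TwoSidedIdeal.mul_mem_left _ _ _ (TwoSidedIdeal.mul_mem_left _ _ _ (hZ h)))
end

section
/- Graded Jacobi identity for the zero-locus derived bracket (equation (3.x)/(main:JacobiZLR) of the paper): Let A be a ℤ-graded commutative ℝ-algebra with a graded Poisson bracket [·,·] of degree −n and a compatible Q-structure Z. Then for all homogeneous f, g, h ∈ A one has [f, Z([g, Z(h)])] − [[f, Z(g)], Z(h)] − (−1)^{(|f|+n+1)(|g|+n+1)} [g, Z([f, Z(h)])] ∈ I_Z; that is, the derived bracket induced on the quotient A/I_Z satisfies the graded Jacobi identity {F,{G,H}} = {{F,G},H} + (−1)^{(|F|+n+1)(|G|+n+1)}{G,{F,H}} of a degree −(n−1) graded Poisson bracket. -/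
/-- **Graded Jacobi identity for the zero-locus derived bracket**: for homogeneous
`f, g, h`,
`[f, Z[g, Z h]] − [[f, Z g], Z h] − (−1)^{(|f|+n+1)(|g|+n+1)} [g, Z[f, Z h]] ∈ I_Z`. -/
theorem derived_bracket_jacobi
    {A : Type*} [Ring A] [Algebra ℝ A] {𝒜 : ℤ → Submodule ℝ A} {n : ℤ}
    (P : GradedPoissonBracket A 𝒜 n) (Q : QStructure P)
    (I : TwoSidedIdeal A) (hI : I = TwoSidedIdeal.span (Set.range Q.Z))
    {j k l : ℤ} {f g h : A} (hf : f ∈ 𝒜 j) (hg : g ∈ 𝒜 k) (hh : h ∈ 𝒜 l) :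
    P.bracket f (Q.Z (P.bracket g (Q.Z h)))
      - P.bracket (P.bracket f (Q.Z g)) (Q.Z h)
      - ((-1 : ℝ) ^ ((j + n + 1) * (k + n + 1))) •
          P.bracket g (Q.Z (P.bracket f (Q.Z h))) ∈ I := by
  have hsign : (-1 : ℝ) ^ ((j + n + 1) * (k + n + 1))
      = -((-1 : ℝ) ^ ((j + n) * (k + 1 + n)) * (-1 : ℝ) ^ (k + n)) := by
    rw [show (j + n + 1) * (k + n + 1) = (j + n) * (k + 1 + n) + (k + n) + 1 by ring,
      zpow_add_one₀ (by norm_num), zpow_add₀ (by norm_num)]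
    ring
  have hgh : Q.Z (P.bracket g (Q.Z h)) = P.bracket (Q.Z g) (Q.Z h) := by
    simp [Q.Z_compat hg, Q.Z_sq]
  have hexact : P.bracket f (Q.Z (P.bracket g (Q.Z h)))
      - P.bracket (P.bracket f (Q.Z g)) (Q.Z h)
      - ((-1 : ℝ) ^ ((j + n + 1) * (k + n + 1))) • P.bracket g (Q.Z (P.bracket f (Q.Z h)))
      = Q.Z ((-1 : ℝ) ^ ((j + n) * (k + 1 + n)) • P.bracket g (P.bracket f (Q.Z h))) := by
    rw [hgh, P.jacobi hf (Q.Z_mem hg) (Q.Z_mem hh), hsign, map_smul, Q.Z_compat hg]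
    module
  rw [hexact, hI]
  exact TwoSidedIdeal.subset_span ⟨_, rfl⟩
end

section
/- Dirac structures carry a Lie algebra of anomaly-free currents (algebraic form of the Proposition in section 4.2 of the paper): Let A be a ℤ-graded commutative ℝ-algebra with a graded Poisson bracket [·,·] of degree −n and a compatible Q-structure Z, and let L ⊆ A_{n−1} be an isotropic and involutive subspace. Then L, equipped with the derived bracket {f, g} := [f, Z(g)], is a Lie algebra over ℝ: the bracket is ℝ-bilinear with values in L, antisymmetric ({g, f} = −{f, g} for all f, g ∈ L), and satisfies exactly (not merely modulo I_Z) the identity {f, {g, h}} = {{f, g}, h} + {g, {f, h}} for all f, g, h ∈ L. -/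
/-- **Dirac structures carry a Lie algebra of anomaly-free currents** (section 4.2):
if `L ⊆ A_{n−1}` is isotropic and involutive, then the derived bracket
`{f, g} = [f, Z g]` makes `L` a Lie algebra over ℝ: it takes values in `L`, is
antisymmetric, and satisfies the (exact) Jacobi identity
`{f,{g,h}} = {{f,g},h} + {g,{f,h}}`. -/
theorem dirac_structure_lie_algebra
    {A : Type*} [Ring A] [Algebra ℝ A] {𝒜 : ℤ → Submodule ℝ A} {n : ℤ}
    (P : GradedPoissonBracket A 𝒜 n) (Q : QStructure P)
    (L : Submodule ℝ A) (hL : ∀ f ∈ L, f ∈ 𝒜 (n - 1))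
    (hiso : ∀ f ∈ L, ∀ g ∈ L, P.bracket f g = 0)
    (hinv : ∀ f ∈ L, ∀ g ∈ L, P.bracket f (Q.Z g) ∈ L) :
    -- the derived bracket takes values in `L`
    (∀ f ∈ L, ∀ g ∈ L, P.bracket f (Q.Z g) ∈ L) ∧
    -- antisymmetry
    (∀ f ∈ L, ∀ g ∈ L, P.bracket g (Q.Z f) = -(P.bracket f (Q.Z g))) ∧
    -- exact Jacobi identity
    (∀ f ∈ L, ∀ g ∈ L, ∀ h ∈ L,
      P.bracket f (Q.Z (P.bracket g (Q.Z h)))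
        = P.bracket (P.bracket f (Q.Z g)) (Q.Z h)
          + P.bracket g (Q.Z (P.bracket f (Q.Z h)))) := by
  have bracket_Z : ∀ f ∈ 𝒜 (n - 1), ∀ g : A,
      Q.Z (P.bracket f g) = P.bracket (Q.Z f) g - P.bracket f (Q.Z g) := by
    intro f hf g
    have hodd : Odd (n - 1 + n) := ⟨n - 1, by ring⟩
    rw [Q.Z_compat hf g, hodd.neg_one_zpow, neg_one_smul, sub_eq_add_neg]
  have Z_bracket_eq : ∀ f ∈ L, ∀ g ∈ L, P.bracket (Q.Z f) g = P.bracket f (Q.Z g) := by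
    intro f hf g hg
    have h := bracket_Z f (hL f hf) g
    rw [hiso f hf g hg, map_zero] at h
    exact sub_eq_zero.mp h.symm
  have heven : Even ((n - 1 + n) * (n - 1 + 1 + n)) :=
    Even.mul_left ⟨n, by ring⟩ _
  refine ⟨hinv, ?_, ?_⟩
  · intro f hf g hg
    rw [P.antisymm (hL g hg) (Q.Z_mem (hL f hf)), heven.neg_one_zpow, one_smul,
      Z_bracket_eq f hf g hg]
  · intro f hf g hg h hh
    rw [bracket_Z g (hL g hg), Q.Z_sq, map_zero, sub_zero,
      P.jacobi (hL f hf) (Q.Z_mem (hL g hg)) (Q.Z_mem (hL h hh)),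
      heven.neg_one_zpow, one_smul, Z_bracket_eq g hg _ (hinv f hf h hh)]
end
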